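/- Let s be a vertex of Γ. Then the centralizer of s in A_Γ is the special subgroup generated by s together with all vertices adjacent to s, i.e., C(s) = ⟨st(s)⟩ where st(s) = {s} ∪ link(s). -/

import Mathlib

/-- The commutator relations of the right-angled Artin group of a graph `G`. -/
def raagRels {V : Type*} (G : SimpleGraph V) : Set (FreeGroup V) :=
  {r | ∃ s t : V, G.Adj s t ∧
    r = FreeGroup.of s * FreeGroup.of t * (FreeGroup.of s)⁻¹ * (FreeGroup.of t)⁻¹}

/-- The right-angled Artin group of a graph `G`. -/
abbrev RAAG {V : Type*} (G : SimpleGraph V) : Type _ := PresentedGroup (raagRels G)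

namespace FreeGroup

theorem mk_mem_zpowers_of_commute {α : Type*} (x : α) (L : List (α × Bool)) (hL : IsReduced L)
    (h : Commute (of x) (mk L)) : mk L ∈ Subgroup.zpowers (of x) := by
  classical
  induction L with
  | nil => exact one_mem _
  | cons a t ih =>
    obtain ⟨y, b⟩ := a
    have hsplit : (mk ((y, b) :: t) : FreeGroup α) = mk [(y, b)] * mk t := by
      rw [mul_mk, List.singleton_append]
    by_cases hy : y = x
    · subst hy
      have hmem : (mk [(y, b)] : FreeGroup α) ∈ Subgroup.zpowers (of y) := by
        cases b with
        | true => exact Subgroup.mem_zpowers (of y)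
        | false => exact inv_mem (Subgroup.mem_zpowers (of y))
      have hcomm : Commute (of y) (mk [(y, b)] : FreeGroup α) := by
        obtain ⟨k, hk⟩ := Subgroup.mem_zpowers_iff.1 hmem
        rw [← hk]
        exact (Commute.refl _).zpow_right k
      have ht : (mk t : FreeGroup α) = (mk [(y, b)])⁻¹ * mk ((y, b) :: t) := by
        rw [hsplit, inv_mul_cancel_left]
      rw [hsplit]
      refine mul_mem hmem (ih (List.IsChain.tail hL) ?_)
      rw [ht]
      exact hcomm.inv_right.mul_right h
    · exfalso
      have hred : IsReduced ((x, true) :: (y, b) :: t) :=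
        List.isChain_cons_cons.2 ⟨fun e => absurd e.symm hy, hL⟩
      have hword : (of x * mk ((y, b) :: t)).toWord = (x, true) :: (y, b) :: t := by
        rw [of, mul_mk, toWord_mk]
        exact hred.reduce_eq
      have hsub := toWord_mul_sublist (mk ((y, b) :: t)) (of x)
      rw [← h.eq, hword, toWord_mk, hL.reduce_eq, toWord_of] at hsub
      have heq := hsub.eq_of_length (by simp)
      rw [List.cons_append, List.cons.injEq, Prod.mk.injEq] at heq
      exact hy heq.1.1.symm

theorem mem_zpowers_of_commute_of {α : Type*} {x : α} {f : FreeGroup α}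
    (h : Commute (of x) f) : f ∈ Subgroup.zpowers (of x) := by
  classical
  have hf : mk f.toWord = f := mk_toWord
  rw [← hf] at h ⊢
  exact mk_mem_zpowers_of_commute x _ isReduced_toWord h

/-- A group acting on a set acts by automorphisms on the free group on that set. -/
def mulActionHom (A X : Type*) [Group A] [MulAction A X] : A →* MulAut (FreeGroup X) where
  toFun a := freeGroupCongr (MulAction.toPerm a)
  map_one' := by
    ext f
    induction f using FreeGroup.induction_on <;> simp_all
  map_mul' a b := by
    ext f
    induction f using FreeGroup.induction_on <;> simp_all [mul_smul]

@[simp]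
theorem mulActionHom_of {A X : Type*} [Group A] [MulAction A X] (a : A) (x : X) :
    mulActionHom A X a (of x) = of (a • x) := by
  simp [mulActionHom]

end FreeGroup

namespace RAAG

variable {V : Type*} (G : SimpleGraph V) (s : V)

theorem commute_of_of_adj {t u : V} (h : G.Adj t u) :
    Commute (PresentedGroup.of t : RAAG G) (PresentedGroup.of u) := by
  have h1 : PresentedGroup.mk (raagRels G) (FreeGroup.of t * FreeGroup.of u *
      (FreeGroup.of t)⁻¹ * (FreeGroup.of u)⁻¹) = 1 :=
    (PresentedGroup.mk_eq_one_iff).2 (Subgroup.subset_normalClosure ⟨t, u, h, rfl⟩)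
  rw [map_mul, map_mul, map_mul, map_inv, map_inv, mul_inv_eq_one, mul_inv_eq_iff_eq_mul] at h1
  exact h1.trans rfl

/-- The special subgroup generated by the link of a vertex. -/
def linkSubgroup : Subgroup (RAAG G) :=
  Subgroup.closure (PresentedGroup.of '' {t : V | G.Adj s t})

theorem commute_of_mem_linkSubgroup {a : RAAG G} (ha : a ∈ linkSubgroup G s) :
    Commute (PresentedGroup.of s) a := by
  have hle : linkSubgroup G s ≤ Subgroup.centralizer {PresentedGroup.of s} := by
    refine (Subgroup.closure_le _).2 ?_
    rintro _ ⟨t, ht, rfl⟩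
    exact Subgroup.mem_centralizer_singleton_iff.2 (commute_of_of_adj G ht).eq.symm
  exact (Subgroup.mem_centralizer_singleton_iff.1 (hle ha)).symm

/-- The semidirect product of the free group on the cosets of `linkSubgroup G s` with `RAAG G`. -/
abbrev CosetProduct : Type _ :=
  FreeGroup (RAAG G ⧸ linkSubgroup G s) ⋊[FreeGroup.mulActionHom (RAAG G) _] RAAG G

open Classical in
/-- The homomorphism sending `s` to the free generator of the trivial coset and every other
vertex to itself. -/
noncomputable def toCosetProduct : RAAG G →* CosetProduct G s :=
  PresentedGroup.toGroup (f := fun v => if v = s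
      then SemidirectProduct.inl (FreeGroup.of ((1 : RAAG G) : RAAG G ⧸ linkSubgroup G s))
      else SemidirectProduct.inr (PresentedGroup.of v)) <| by
    have key : ∀ t, G.Adj s t → Commute
        (SemidirectProduct.inl (FreeGroup.of ((1 : RAAG G) : RAAG G ⧸ linkSubgroup G s)) :
          CosetProduct G s)
        (SemidirectProduct.inr (PresentedGroup.of t)) := by
      intro t ht
      have hmem : ((PresentedGroup.of t : RAAG G) : RAAG G ⧸ linkSubgroup G s) =
          ((1 : RAAG G) : RAAG G ⧸ linkSubgroup G s) := by
        rw [eq_comm, QuotientGroup.eq, inv_one, one_mul]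
        exact Subgroup.subset_closure ⟨t, ht, rfl⟩
      ext <;> simp [hmem]
    rintro _ ⟨t, u, h, rfl⟩
    simp only [map_mul, map_inv, FreeGroup.lift_apply_of]
    rw [mul_inv_eq_one, mul_inv_eq_iff_eq_mul]
    split_ifs with ht hu hu
    · exact absurd (ht.trans hu.symm) h.ne
    · exact key u (ht ▸ h)
    · exact (key t (hu ▸ h.symm)).symm
    · rw [← map_mul, ← map_mul, (commute_of_of_adj G h).eq]

/-- The homomorphism sending the free generator of the coset of `a` to the conjugate of `s`
by `a`. -/
def ofCosetProduct : CosetProduct G s →* RAAG G :=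
  SemidirectProduct.lift
    (FreeGroup.lift fun q => Quotient.liftOn' q
      (fun a => a * PresentedGroup.of s * a⁻¹) <| by
        intro a b hab
        have h := commute_of_mem_linkSubgroup G s (QuotientGroup.leftRel_apply.1 hab)
        have hb : b = a * (a⁻¹ * b) := by group
        change a * _ * a⁻¹ = b * _ * b⁻¹
        rw [hb, mul_assoc a (a⁻¹ * b), ← h.eq]
        group)
    (MonoidHom.id _) <| by
      intro g
      ext q
      induction q using QuotientGroup.induction_on with
      | H a => simp [mul_assoc]

theorem ofCosetProduct_toCosetProduct (g : RAAG G) :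
    ofCosetProduct G s (toCosetProduct G s g) = g := by
  have h : (ofCosetProduct G s).comp (toCosetProduct G s) = MonoidHom.id _ := by
    ext v
    by_cases hv : v = s
    · subst hv
      simp [toCosetProduct, ofCosetProduct]
    · simp [toCosetProduct, ofCosetProduct, hv]
  exact DFunLike.congr_fun h g

end RAAG

/-- The centralizer of a generator `s` of a right-angled Artin group is the special
subgroup generated by `s` together with the vertices adjacent to `s`. -/
theorem raag_centralizer_of_generator {V : Type*} [Fintype V] (G : SimpleGraph V)
    (s : V) :
    Subgroup.centralizer {(PresentedGroup.of s : RAAG G)} =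
      Subgroup.closure (PresentedGroup.of '' ({s} ∪ {t : V | G.Adj s t})) := by
  apply le_antisymm
  · intro g hg
    have hcomm : Commute (PresentedGroup.of s) g :=
      (Subgroup.mem_centralizer_singleton_iff.1 hg).symm
    have hs : RAAG.toCosetProduct G s (PresentedGroup.of s) =
        SemidirectProduct.inl (FreeGroup.of ((1 : RAAG G) : RAAG G ⧸ RAAG.linkSubgroup G s)) := by
      simp [RAAG.toCosetProduct]
    have himage := (hcomm.map (RAAG.toCosetProduct G s)).eq
    have hg' := RAAG.ofCosetProduct_toCosetProduct G s g
    rw [hs] at himage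
    generalize RAAG.toCosetProduct G s g = p at himage hg'
    obtain ⟨f, a⟩ := p
    have hleft := congrArg SemidirectProduct.left himage
    simp only [SemidirectProduct.mul_left, SemidirectProduct.left_inl,
      SemidirectProduct.right_inl, map_one, MulAut.one_apply, FreeGroup.mulActionHom_of,
      MulAction.Quotient.smul_coe, smul_eq_mul, mul_one] at hleft
    have hcoset : ((1 : RAAG G) : RAAG G ⧸ RAAG.linkSubgroup G s) = a := by
      have := congrArg Abelianization.of hleft
      rw [map_mul, map_mul, mul_comm, mul_right_inj] at this
      exact FreeAbelianGroup.of_injective this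
    have ha : a ∈ RAAG.linkSubgroup G s := by
      simpa using QuotientGroup.eq.1 hcoset
    rw [← hcoset] at hleft
    obtain ⟨k, rfl⟩ := Subgroup.mem_zpowers_iff.1 (FreeGroup.mem_zpowers_of_commute_of hleft)
    rw [← hg']
    refine mul_mem ?_ (Subgroup.closure_mono (Set.image_mono Set.subset_union_right) ha)
    have hmem : (PresentedGroup.of s : RAAG G) ∈
        Subgroup.closure (PresentedGroup.of '' ({s} ∪ {t : V | G.Adj s t})) :=
      Subgroup.subset_closure ⟨s, Or.inl rfl, rfl⟩
    simpa using zpow_mem hmem k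
  · refine (Subgroup.closure_le _).2 ?_
    rintro _ ⟨t, rfl | ht, rfl⟩
    · exact Subgroup.mem_centralizer_singleton_iff.2 rfl
    · exact Subgroup.mem_centralizer_singleton_iff.2 (RAAG.commute_of_of_adj G ht).eq.symm
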